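/- arXiv:2305.05995 — 3 statements merged into one kernel-verified Lean document; each statement's English description precedes it below -/
import Mathlib

section
/- Let K be a field, c ∈ K, and let a, b, d, f : ℕ → K be sequences with aₙ ≠ 0 for all n, satisfying for every n ≥ 0 the recursions: a_{n+1} = (aₙ³ − aₙ²·dₙ + aₙ·bₙ·c − bₙ²)/aₙ² (i.e., a_{n+1} = −(aₙ³·eₙ + aₙ²·dₙ − aₙ·bₙ·c + bₙ²)/aₙ² with eₙ = −1), b_{n+1} = −(aₙ⁴·fₙ + c·aₙ³·dₙ − aₙ²·c²·bₙ + 2·aₙ·c·bₙ² − aₙ²·bₙ·dₙ − bₙ³)/aₙ³, d_{n+1} = −(aₙ²·dₙ − 2·aₙ·bₙ·c + 2·bₙ²)/aₙ², and f_{n+1} = −bₙ/aₙ. Then for all n ≥ 0, a_{n+2}·a_{n+1} + a_{n+1}·aₙ = 2·a₀·a₁ + a₀·(2·f₁ + c)·(f₀ + c + f₁) − a₀²·(f₀ + c + f₁)²/a_{n+1}. -/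
theorem recursion_system_identity {K : Type*} [Field K] (c : K) (a b d f : ℕ → K)
    (ha : ∀ n, a n ≠ 0)
    (hra : ∀ n : ℕ, a (n + 1)
        = (a n ^ 3 - a n ^ 2 * d n + a n * b n * c - b n ^ 2) / a n ^ 2)
    (hrb : ∀ n : ℕ, b (n + 1)
        = -(a n ^ 4 * f n + c * a n ^ 3 * d n - a n ^ 2 * c ^ 2 * b n
            + 2 * a n * c * b n ^ 2 - a n ^ 2 * b n * d n - b n ^ 3) / a n ^ 3)
    (hrd : ∀ n : ℕ, d (n + 1) = -(a n ^ 2 * d n - 2 * a n * b n * c + 2 * b n ^ 2) / a n ^ 2)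
    (hrf : ∀ n : ℕ, f (n + 1) = -(b n) / a n) :
    ∀ n : ℕ, a (n + 2) * a (n + 1) + a (n + 1) * a n
      = 2 * a 0 * a 1 + a 0 * (2 * f 1 + c) * (f 0 + c + f 1)
        - a 0 ^ 2 * (f 0 + c + f 1) ^ 2 / a (n + 1) := by
  have hb : ∀ n, b n = -(a n * f (n + 1)) := fun n => by
    rw [hrf]; field_simp [ha n]
  have ha' : ∀ n, a (n + 1) = a n - d n - f (n + 1) * (f (n + 1) + c) := fun n => by
    have h := ha n
    rw [hra, hb]; field_simp; ring
  have hd' : ∀ n, d (n + 1) = -d n - 2 * f (n + 1) * (f (n + 1) + c) := fun n => by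
    have h := ha n
    rw [hrd, hb]; field_simp; ring
  have hb' : ∀ n, a (n + 1) * f (n + 2)
      = a n * f n + (c + f (n + 1)) * (d n + f (n + 1) * (c + f (n + 1))) := fun n => by
    have h := ha n
    have h1 := hrb n
    rw [hb (n + 1), hb n] at h1
    rw [← neg_inj, h1]; field_simp; ring
  -- The quantity `a n * (f n + c + f (n + 1))` is conserved.
  have hA : ∀ n, a n * (f n + c + f (n + 1)) = a 0 * (f 0 + c + f 1) := fun n => by
    induction n with
    | zero => rfl
    | succ n ih => linear_combination ih + hb' n + (c + f (n + 1)) * ha' n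
  have hstep : ∀ n, a (n + 2) * a (n + 1)
      = a n * a (n + 1) + (f (n + 1) - f (n + 2)) * (a 0 * (f 0 + c + f 1)) := fun n => by
    linear_combination a (n + 1) * (ha' (n + 1) - hd' n + ha' n)
      + (f (n + 1) - f (n + 2)) * hA (n + 1)
  have hI : ∀ n, 2 * a n * a (n + 1) + (2 * f (n + 1) + c) * (a 0 * (f 0 + c + f 1))
      = 2 * a 0 * a 1 + (2 * f 1 + c) * (a 0 * (f 0 + c + f 1)) := fun n => by
    induction n with
    | zero => rfl
    | succ n ih => linear_combination ih + 2 * hstep n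
  intro n
  have hdiv : a 0 ^ 2 * (f 0 + c + f 1) ^ 2 / a (n + 1)
      = (a 0 * (f 0 + c + f 1)) * (f (n + 1) + c + f (n + 2)) := by
    rw [div_eq_iff (ha (n + 1))]
    linear_combination -(a 0 * (f 0 + c + f 1)) * hA (n + 1)
  rw [hdiv]
  linear_combination hstep n + hI n
end

section
/- Let K be a field, let c, f₀, f₁ ∈ K, and let a : ℕ → K be a sequence with aₙ ≠ 0 for all n. Write a₀ = a(0), a₁ = a(1), and suppose that for all n ≥ 2: aₙ · a_{n−1}² = (2·a₀·a₁ + a₀·(f₀ + f₁ + c)·(2·f₁ + c))·a_{n−1} − a₀²·(f₀ + f₁ + c)² − a_{n−2}·a_{n−1}². Set α = a₀²·(c + f₀ + f₁)² and β = −(c + f₀ + f₁)²·a₀³ − a₁·((f₀ − f₁)·(c + f₀ + f₁) − a₁)·a₀². Then for all n ≥ 2, aₙ · a_{n−1}² · a_{n−2} = α · a_{n−1} + β. -/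
theorem somos_recursion_from_three_term {K : Type*} [Field K] (c f0 f1 : K) (a : ℕ → K)
    (ha : ∀ n, a n ≠ 0)
    (hrec : ∀ n : ℕ, 2 ≤ n →
      a n * a (n - 1) ^ 2
        = (2 * a 0 * a 1 + a 0 * (f0 + f1 + c) * (2 * f1 + c)) * a (n - 1)
          - a 0 ^ 2 * (f0 + f1 + c) ^ 2 - a (n - 2) * a (n - 1) ^ 2)
    (α β : K)
    (hα : α = a 0 ^ 2 * (c + f0 + f1) ^ 2)
    (hβ : β = -(c + f0 + f1) ^ 2 * a 0 ^ 3
        - a 1 * ((f0 - f1) * (c + f0 + f1) - a 1) * a 0 ^ 2) :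
    ∀ n : ℕ, 2 ≤ n → a n * a (n - 1) ^ 2 * a (n - 2) = α * a (n - 1) + β := by
  have invariant : ∀ n : ℕ, a n ^ 2 * a (n + 1) ^ 2
      - (2 * a 0 * a 1 + a 0 * (f0 + f1 + c) * (2 * f1 + c)) * a n * a (n + 1)
      + α * (a n + a (n + 1)) + β = 0 := by
    intro n
    induction n with
    | zero => subst hα hβ; ring
    | succ n ih =>
      have h : a (n + 2) * a (n + 1) ^ 2 = _ := hrec (n + 2) (by lia)
      simp only [Nat.add_sub_cancel, show n + 2 - 1 = n + 1 from rfl] at h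
      subst hα
      linear_combination ih + (a (n + 2) - a n) * h
  intro n hn
  obtain ⟨m, rfl⟩ := Nat.exists_eq_add_of_le' hn
  have h := hrec (m + 2) hn
  simp only [Nat.add_sub_cancel, show m + 2 - 1 = m + 1 from rfl] at h ⊢
  subst hα
  linear_combination a m * h - invariant m
end

section
/- Let R be a commutative ring, let α, β ∈ R, let a : ℕ → R be a sequence, and define sₙ = ∏_{i=0}^{n−1} a_i^{n−i} for n ≥ 0 (so s₀ = 1). Suppose that for all m ≥ 2, a_m · a_{m−1}² · a_{m−2} = α · a_{m−1} + β. Then for all n ≥ 4, sₙ · s_{n−4} = α · s_{n−1} · s_{n−3} + β · s_{n−2}². -/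
theorem prod_range_succ_pow_sub {M : Type*} [CommMonoid M] (a : ℕ → M) (n : ℕ) :
    ∏ i ∈ Finset.range (n + 1), a i ^ (n + 1 - i) =
      (∏ i ∈ Finset.range n, a i ^ (n - i)) * ∏ i ∈ Finset.range (n + 1), a i := by
  rw [Finset.prod_range_succ, Finset.prod_range_succ a, ← mul_assoc, ← Finset.prod_mul_distrib,
    Nat.add_sub_cancel_left, pow_one]
  congr 1
  refine Finset.prod_congr rfl fun i hi => ?_
  rw [← pow_succ, Nat.sub_add_comm (Finset.mem_range.mp hi).le]

theorem somos_from_product {R : Type*} [CommRing R] (α β : R) (a : ℕ → R)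
    (s : ℕ → R) (hs : ∀ n : ℕ, s n = ∏ i ∈ Finset.range n, a i ^ (n - i))
    (hrec : ∀ m : ℕ, 2 ≤ m → a m * a (m - 1) ^ 2 * a (m - 2) = α * a (m - 1) + β) :
    ∀ n : ℕ, 4 ≤ n →
      s n * s (n - 4) = α * s (n - 1) * s (n - 3) + β * s (n - 2) ^ 2 := by
  intro n hn
  obtain ⟨k, rfl⟩ := Nat.exists_eq_add_of_le' hn
  have hsucc (m : ℕ) : s (m + 1) = s m * ∏ i ∈ Finset.range (m + 1), a i := by
    rw [hs, hs, prod_range_succ_pow_sub]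
  have h : a (k + 3) * a (k + 2) ^ 2 * a (k + 1) = α * a (k + 2) + β :=
    hrec (k + 3) (by lia)
  change s (k + 4) * s k = α * s (k + 3) * s (k + 1) + β * s (k + 2) ^ 2
  simp only [hsucc, Finset.prod_range_succ]
  linear_combination
    s k ^ 2 * (∏ i ∈ Finset.range k, a i) ^ 4 * a k ^ 4 * a (k + 1) ^ 2 * h
end
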